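/- arXiv:2112.06065 — 2 statements merged into one kernel-verified Lean document; each statement's English description precedes it below -/
import Mathlib

section
/- Let the symmetric group S₄ act on ℝ⁴ by permuting coordinates, (π • x)ᵢ = x_{π⁻¹(i)}, and let U = {x ∈ ℝ⁴ : x₀ + x₁ + x₂ + x₃ = 0}, which is an S₄-stable subspace. Then the three vectors u₁ = (1, 1, −1, −1), u₂ = (1, −1, 1, −1), u₃ = (1, −1, −1, 1) form a basis of U, and this basis is S₄-invariant up to sign: every permutation π ∈ S₄ sends each uᵢ to ±uⱼ for some j. -/
/-- The coordinate-permutation action of `π ∈ S₄` on `ℝ⁴`: `(π • x) i = x (π⁻¹ i)`. -/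
def permAct (π : Equiv.Perm (Fin 4)) : (Fin 4 → ℝ) →ₗ[ℝ] (Fin 4 → ℝ) :=
  LinearMap.funLeft ℝ ℝ ⇑π⁻¹

/-- The subspace `U = {x ∈ ℝ⁴ : x₀ + x₁ + x₂ + x₃ = 0}`. -/
noncomputable def sumZero : Submodule ℝ (Fin 4 → ℝ) :=
  LinearMap.ker ((∑ i : Fin 4, LinearMap.proj i : (Fin 4 → ℝ) →ₗ[ℝ] ℝ))

/-- The three vectors `(1,1,-1,-1)`, `(1,-1,1,-1)`, `(1,-1,-1,1)`. -/
noncomputable def tetraVecs : Fin 3 → (Fin 4 → ℝ) :=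
  ![![1, 1, -1, -1], ![1, -1, 1, -1], ![1, -1, -1, 1]]

def tetraInt : Fin 3 → (Fin 4 → ℤ) :=
  ![![1, 1, -1, -1], ![1, -1, 1, -1], ![1, -1, -1, 1]]

theorem tetraVecs_cast (i : Fin 3) (k : Fin 4) : tetraVecs i k = (tetraInt i k : ℝ) := by
  fin_cases i <;> fin_cases k <;> simp [tetraVecs, tetraInt]

set_option maxRecDepth 100000 in
theorem tetraInt_perm : ∀ (π : Equiv.Perm (Fin 4)) (i : Fin 3), ∃ j,
    (∀ k, tetraInt i (π k) = tetraInt j k) ∨ (∀ k, tetraInt i (π k) = -tetraInt j k) := by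
  decide

theorem mem_sumZero_iff (x : Fin 4 → ℝ) : x ∈ sumZero ↔ ∑ i, x i = 0 := by
  simp [sumZero, LinearMap.mem_ker]

theorem permAct_mem (π : Equiv.Perm (Fin 4)) (x : Fin 4 → ℝ) (hx : x ∈ sumZero) :
    permAct π x ∈ sumZero := by
  rw [mem_sumZero_iff] at *
  rw [← hx]
  exact Equiv.sum_comp π⁻¹ x

theorem tetraVecs_mem (j : Fin 3) : tetraVecs j ∈ sumZero := by
  rw [mem_sumZero_iff]
  fin_cases j <;> simp [tetraVecs, Fin.sum_univ_four]

/-- `U` is `S₄`-stable, the vectors `u₁ = (1,1,−1,−1)`, `u₂ = (1,−1,1,−1)`,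
`u₃ = (1,−1,−1,1)` form a basis of `U`, and this basis is `S₄`-invariant up to sign. -/
theorem tetraVecs_basis_invariant :
    (∀ π : Equiv.Perm (Fin 4), sumZero.map (permAct π) = sumZero) ∧
    (∀ j, tetraVecs j ∈ sumZero) ∧
    LinearIndependent ℝ tetraVecs ∧
    Submodule.span ℝ (Set.range tetraVecs) = sumZero ∧
    (∀ (π : Equiv.Perm (Fin 4)) (i : Fin 3), ∃ j,
      permAct π (tetraVecs i) = tetraVecs j ∨ permAct π (tetraVecs i) = -tetraVecs j) := by
  refine ⟨fun π => ?_, tetraVecs_mem, ?_, ?_, fun π i => ?_⟩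
  · apply le_antisymm
    · rintro _ ⟨x, hx, rfl⟩
      exact permAct_mem π x hx
    · intro x hx
      refine ⟨permAct π⁻¹ x, permAct_mem _ x hx, ?_⟩
      ext k
      simp [permAct, LinearMap.funLeft_apply]
  · rw [Fintype.linearIndependent_iff]
    intro g hg
    have h0 := congrFun hg 0
    have h1 := congrFun hg 1
    have h2 := congrFun hg 2
    have h3 := congrFun hg 3
    simp [tetraVecs, Fin.sum_univ_three] at h0 h1 h2 h3
    intro i
    fin_cases i <;> simp <;> linarith
  · apply le_antisymm
    · rw [Submodule.span_le]
      rintro _ ⟨j, rfl⟩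
      exact tetraVecs_mem j
    · intro x hx
      rw [mem_sumZero_iff, Fin.sum_univ_four] at hx
      rw [Submodule.mem_span_range_iff_exists_fun]
      refine ⟨![(x 0 + x 1) / 2, (x 0 + x 2) / 2, (x 0 + x 3) / 2], ?_⟩
      ext k
      fin_cases k <;> simp [tetraVecs, Fin.sum_univ_three] <;> linarith
  · obtain ⟨j, h | h⟩ := tetraInt_perm π⁻¹ i
    · refine ⟨j, Or.inl ?_⟩
      ext k
      rw [permAct, LinearMap.funLeft_apply, tetraVecs_cast, tetraVecs_cast, h k]
    · refine ⟨j, Or.inr ?_⟩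
      ext k
      rw [permAct, LinearMap.funLeft_apply, Pi.neg_apply, tetraVecs_cast, tetraVecs_cast, h k]
      push_cast
      rfl
end

section
/- Let ρ₂ be the representation of the cyclic group ℤ/3 = ⟨g⟩ on ℝ² in which the generator g acts as rotation by 2π/3, i.e., by the matrix [[-1/2, -√3/2], [√3/2, -1/2]]. Then ℝ² with this ℤ/3-action has no ℤ/3-invariant basis up to sign: there do not exist two linearly independent vectors b₁, b₂ ∈ ℝ² such that g • bᵢ ∈ {b₁, −b₁, b₂, −b₂} for i = 1, 2. -/
/-- Rotation of `ℝ²` through `2π/3`, the action of the generator of `ℤ/3` in the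
two-dimensional rotation representation. -/
noncomputable def rot : (Fin 2 → ℝ) →ₗ[ℝ] (Fin 2 → ℝ) :=
  Matrix.toLin' !![-(1 / 2 : ℝ), -(Real.sqrt 3) / 2; (Real.sqrt 3) / 2, -(1 / 2 : ℝ)]

theorem rot0 (v : Fin 2 → ℝ) : rot v 0 = -(1 / 2) * v 0 + -(Real.sqrt 3) / 2 * v 1 := by
  rw [rot, Matrix.toLin'_apply, Matrix.mulVec, dotProduct, Fin.sum_univ_two]
  rfl

theorem rot1 (v : Fin 2 → ℝ) : rot v 1 = (Real.sqrt 3) / 2 * v 0 + -(1 / 2) * v 1 := by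
  rw [rot, Matrix.toLin'_apply, Matrix.mulVec, dotProduct, Fin.sum_univ_two]
  rfl

theorem rot_key (v : Fin 2 → ℝ) : rot (rot v) + rot v + v = 0 := by
  have h3 : Real.sqrt 3 * Real.sqrt 3 = 3 := Real.mul_self_sqrt (by norm_num)
  ext i
  fin_cases i
  · simp [rot0, rot1]
    linear_combination (-(v 0) / 4) * h3
  · simp [rot0, rot1]
    linear_combination (-(v 1) / 4) * h3

/-- `ℝ²` with the rotation action of `ℤ/3` has no `ℤ/3`-invariant basis up to sign: there
are no two linearly independent vectors `b₁, b₂` such that the generator sends each `bᵢ`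
into `{b₁, −b₁, b₂, −b₂}`. -/
theorem no_invariant_basis_rot :
    ¬ ∃ b₁ b₂ : Fin 2 → ℝ, LinearIndependent ℝ ![b₁, b₂] ∧
      (rot b₁ = b₁ ∨ rot b₁ = -b₁ ∨ rot b₁ = b₂ ∨ rot b₁ = -b₂) ∧
      (rot b₂ = b₁ ∨ rot b₂ = -b₁ ∨ rot b₂ = b₂ ∨ rot b₂ = -b₂) := by
  rintro ⟨b₁, b₂, hli, h1, h2⟩
  rw [LinearIndependent.pair_iff] at hli
  have k1 := rot_key b₁
  have k2 := rot_key b₂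
  have H : ∀ s t : ℝ, (s ≠ 0 ∨ t ≠ 0) → s • b₁ + t • b₂ = 0 → False := by
    intro s t hst h
    obtain ⟨hs, ht⟩ := hli s t h
    rcases hst with h | h
    · exact h hs
    · exact h ht
  rcases h1 with h1 | h1 | h1 | h1
  · rw [h1, h1] at k1
    exact H 3 0 (by norm_num) (by rw [← k1]; module)
  · rw [h1, map_neg, h1] at k1
    exact H 1 0 (by norm_num) (by rw [← k1]; module)
  · rw [h1] at k1
    rcases h2 with h2 | h2 | h2 | h2 <;> rw [h2] at k1
    · exact H 2 1 (by norm_num) (by rw [← k1]; module)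
    · exact H 0 1 (by norm_num) (by rw [← k1]; module)
    · exact H 1 2 (by norm_num) (by rw [← k1]; module)
    · exact H 1 0 (by norm_num) (by rw [← k1]; module)
  · rw [h1, map_neg] at k1
    rcases h2 with h2 | h2 | h2 | h2 <;> rw [h2] at k1
    · exact H 0 (-1) (by norm_num) (by rw [← k1]; module)
    · exact H 2 (-1) (by norm_num) (by rw [← k1]; module)
    · exact H 1 (-2) (by norm_num) (by rw [← k1]; module)
    · exact H 1 0 (by norm_num) (by rw [← k1]; module)
end
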